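/- Let t be the Hermitian idempotent t = (1/2)(1+e^0)·∏_{μ=1}^{d-1}(1/2)(1 + i e^{2μ-1}e^{2μ}) in C⊗Cl(1,2d-1), and let {c^μ}_{μ=1}^{2^d} be the basis of the subalgebra Q generated by e^1, e^3, ..., e^{2d-1} (all ordered products of these d generators). Then the elements τ^μ = (√2)^d c^μ t satisfy (τ^μ, τ^ν) = δ^{μν}, where (U,V) = ⟨U†V⟩₀. -/

import Mathlib

open CliffordAlgebra TensorProduct

/-- The quadratic form of signature (1, m-1) on `Fin m → ℝ`. -/
noncomputable def Qf (m : ℕ) : QuadraticForm ℝ (Fin m → ℝ) :=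
  QuadraticMap.weightedSumSquares ℝ (fun i : Fin m => if (i : ℕ) = 0 then (1 : ℝ) else -1)

/-- The real Clifford algebra Cl(1, m-1). -/
abbrev Cl (m : ℕ) : Type := CliffordAlgebra (Qf m)

/-- The generator e^k of Cl(1,m-1), for k < m (junk value 0 otherwise). -/
noncomputable def eR (m : ℕ) (k : ℕ) : Cl m :=
  if h : k < m then CliffordAlgebra.ι (Qf m) (Pi.single (⟨k, h⟩ : Fin m) 1) else 0

/-- The complexified Clifford algebra ℂ ⊗ Cl(1,m-1). -/
abbrev CCl (m : ℕ) : Type := ℂ ⊗[ℝ] Cl m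

/-- The embedding of the real Clifford algebra into its complexification. -/
noncomputable def inc (m : ℕ) : Cl m →ₐ[ℝ] CCl m := Algebra.TensorProduct.includeRight

/-- The generator e^k inside the complexification. -/
noncomputable def eC (m : ℕ) (k : ℕ) : CCl m := inc m (eR m k)

/-- The list of commuting factors (1/2)(1 + i e^{2j+1} e^{2j+2}), j = 0, …, k-1,
i.e. (1/2)(1 + i e^{2μ-1} e^{2μ}) for μ = 1, …, k. -/
noncomputable def facs (m k : ℕ) : List (CCl m) :=
  (List.range k).map fun j =>
    (2 : ℂ)⁻¹ • ((1 : CCl m) + Complex.I • (eC m (2 * j + 1) * eC m (2 * j + 2)))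

/-- The idempotent t = (1/2)(1 + e^0) ∏_{μ=1}^{k} (1/2)(1 + i e^{2μ-1} e^{2μ}). -/
noncomputable def tIdem (m k : ℕ) : CCl m :=
  ((2 : ℂ)⁻¹ • ((1 : CCl m) + eC m 0)) * (facs m k).prod

/-- Reversion composed with complex conjugation on ℂ ⊗ Cl(1,m-1). -/
noncomputable def starC (m : ℕ) : CCl m →ₗ[ℝ] CCl m :=
  TensorProduct.map Complex.conjAe.toLinearMap (CliffordAlgebra.reverse (Q := Qf m))

/-- Hermitian conjugation U† = e^0 U* e^0. -/
noncomputable def dagger (m : ℕ) (U : CCl m) : CCl m := eC m 0 * starC m U * eC m 0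

/-- The scalar-part (grade-zero) projection of the real Clifford algebra. -/
noncomputable def scalR (m : ℕ) : Cl m →ₗ[ℝ] ℝ :=
  (ExteriorAlgebra.algebraMapInv (R := ℝ) (M := Fin m → ℝ)).toLinearMap ∘ₗ
    (CliffordAlgebra.equivExterior (Qf m)).toLinearMap

/-- The scalar-part projection ⟨·⟩₀ of the complexified Clifford algebra. -/
noncomputable def scalC (m : ℕ) : CCl m →ₗ[ℝ] ℂ :=
  (TensorProduct.rid ℝ ℂ).toLinearMap ∘ₗ TensorProduct.map LinearMap.id (scalR m)

/-- The inner product (U, V) = ⟨U† V⟩₀. -/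
noncomputable def ip (m : ℕ) (U V : CCl m) : ℂ := scalC m (dagger m U * V)

/-- `x = exp a` in the sense of the usual power series ∑ aᵏ/k!, tested against
all real linear functionals. -/
def IsExpOf (m : ℕ) (a x : Cl m) : Prop :=
  ∀ l : Cl m →ₗ[ℝ] ℝ, HasSum (fun k : ℕ => ((k.factorial : ℝ))⁻¹ • l (a ^ k)) (l x)

/-- The element I = -e¹e² of Cl(1, m-1). -/
noncomputable def Iel (m : ℕ) : Cl m := -(eR m 1 * eR m 2)

/-- The element I = -e¹e² of ℂ ⊗ Cl(1, m-1). -/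
noncomputable def IelC (m : ℕ) : CCl m := -(eC m 1 * eC m 2)

/-- The generators e⁰, e¹, e², e³, e⁵, e⁷, …  (e⁰, e², and odd-index generators). -/
def QpGens (m : ℕ) : Set (Cl m) :=
  {u | ∃ k : ℕ, k < m ∧ (k = 0 ∨ k = 2 ∨ Odd k) ∧ u = eR m k}

/-- The even part Q'⁽⁰⁾ of the real subalgebra Q' generated by e⁰, e¹, e², e³, e⁵, …, e^{2d-1}. -/
noncomputable def Qp0 (m : ℕ) : Subalgebra ℝ (Cl m) :=
  Algebra.adjoin ℝ (QpGens m) ⊓ CliffordAlgebra.even (Qf m)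

/-- The basis element c^S of the subalgebra Q generated by the odd-index generators
e¹, e³, …, e^{2d-1}: the ordered product of e^{2j+1} for j ∈ S. -/
noncomputable def cElt (d : ℕ) (S : Finset (Fin d)) : CCl (2 * d) :=
  ((S.sort (· ≤ ·)).map fun j => eC (2 * d) (2 * (j : ℕ) + 1)).prod

/-- τ^S = (√2)^d c^S t. -/
noncomputable def tau (d : ℕ) (S : Finset (Fin d)) : CCl (2 * d) :=
  (Real.sqrt 2 ^ d : ℝ) • (cElt d S * tIdem (2 * d) (d - 1))

section aux10

theorem aux_contract {M : Type*} [AddCommGroup M] [Module ℝ M] {Q : QuadraticForm ℝ M}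
    (f : Q →qᵢ Q) (d : Module.Dual ℝ M) (x : CliffordAlgebra Q) :
    contractLeft d (CliffordAlgebra.map f x)
      = CliffordAlgebra.map f (contractLeft (d ∘ₗ f.toLinearMap) x) := by
  induction x using CliffordAlgebra.left_induction with
  | algebraMap r => simp [contractLeft_algebraMap]
  | add x y hx hy => simp only [map_add, hx, hy]
  | ι_mul x m hx =>
    rw [map_mul, map_apply_ι, contractLeft_ι_mul, hx, contractLeft_ι_mul, map_sub, map_mul,
      map_apply_ι, map_smul]
    rfl

theorem aux_change {M : Type*} [AddCommGroup M] [Module ℝ M] {Q Q' : QuadraticForm ℝ M}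
    {B : LinearMap.BilinForm ℝ M} (h : B.toQuadraticMap = Q' - Q)
    (f : Q →qᵢ Q) (f' : Q' →qᵢ Q') (hf : ∀ m, f m = f' m) (hB : ∀ m n, B (f m) (f n) = B m n)
    (x : CliffordAlgebra Q) :
    changeForm h (CliffordAlgebra.map f x) = CliffordAlgebra.map f' (changeForm h x) := by
  induction x using CliffordAlgebra.left_induction with
  | algebraMap r => simp
  | add x y hx hy => simp only [map_add, hx, hy]
  | ι_mul x m hx =>
    rw [map_mul, map_apply_ι, changeForm_ι_mul, hx, changeForm_ι_mul, map_sub, map_mul,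
      map_apply_ι, aux_contract, hf]
    congr 4
    ext n
    have := hB m n
    rw [hf, hf] at this
    exact this

theorem aux_scalR_map (m : ℕ) (f : Qf m →qᵢ Qf m) (x : Cl m) :
    scalR m (CliffordAlgebra.map f x) = scalR m x := by
  have key := aux_change (changeForm.associated_neg_proof (Q := Qf m)) f
    { f.toLinearMap with map_app' := fun _ => rfl } (fun _ => rfl) (by
      intro a b
      have h1 : ∀ u, (Qf m) (f u) = Qf m u := f.map_app
      simp only [QuadraticMap.associated_apply, ← map_add, neg_apply, h1]) x
  simp only [scalR, LinearMap.comp_apply, equivExterior, LinearEquiv.coe_coe,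
    AlgHom.toLinearMap_apply, changeFormEquiv_apply]
  rw [key]
  have h2 : (ExteriorAlgebra.algebraMapInv (R := ℝ) (M := Fin m → ℝ)).comp
      (ExteriorAlgebra.map f.toLinearMap) = ExteriorAlgebra.algebraMapInv := by
    apply ExteriorAlgebra.hom_ext
    ext i
    simp [ExteriorAlgebra.algebraMapInv]
  exact DFunLike.congr_fun h2 _

theorem aux_scalR_one (m : ℕ) : scalR m 1 = 1 := by
  simp [scalR]

/-- sign change isometry -/
noncomputable def sgnIso (m : ℕ) (ε : ℕ → ℝ) (h : ∀ i, ε i * ε i = 1) : Qf m →qᵢ Qf m where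
  toFun v := fun i => ε i * v i
  map_add' a b := by ext i; simp [mul_add]
  map_smul' a b := by ext i; simp; ring
  map_app' v := by
    simp only [Qf, QuadraticMap.weightedSumSquares_apply]
    refine Finset.sum_congr rfl fun i _ => ?_
    congr 1
    linear_combination (v i * v i) * h i

noncomputable def sg (m : ℕ) (ε : ℕ → ℝ) (h : ∀ i, ε i * ε i = 1) : Cl m →ₐ[ℝ] Cl m :=
  CliffordAlgebra.map (sgnIso m ε h)

theorem sg_eR (m : ℕ) (ε : ℕ → ℝ) (h : ∀ i, ε i * ε i = 1) (k : ℕ) :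
    sg m ε h (eR m k) = ε k • eR m k := by
  unfold eR
  split_ifs with hk
  · rw [sg, map_apply_ι, ← map_smul]
    congr 1
    ext i
    change ε i * _ = ε k * _
    by_cases hi : i = ⟨k, hk⟩
    · subst hi; simp
    · simp [hi]
  · simp

theorem Qf_add_single (m : ℕ) (i : Fin m) (v : Fin m → ℝ) :
    QuadraticMap.polar (Qf m) (Pi.single i 1) v = 2 * ((if (i : ℕ) = 0 then 1 else -1) * v i) := by
  simp only [QuadraticMap.polar, Qf, QuadraticMap.weightedSumSquares_apply, smul_eq_mul]
  rw [← Finset.sum_sub_distrib, ← Finset.sum_sub_distrib, Finset.sum_eq_single i]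
  · simp only [Pi.add_apply, Pi.single_eq_same]; ring
  · intro j _ hj
    simp [hj]
  · simp

theorem Qf_single (m : ℕ) (i : Fin m) :
    Qf m (Pi.single i 1) = if (i : ℕ) = 0 then 1 else -1 := by
  simp only [Qf, QuadraticMap.weightedSumSquares_apply, smul_eq_mul]
  rw [Finset.sum_eq_single i]
  · simp
  · intro j _ hj
    simp [hj]
  · simp

theorem eR_sq (m k : ℕ) (hk : k < m) :
    eR m k * eR m k = algebraMap ℝ _ (if k = 0 then 1 else -1) := by
  simp only [eR, hk, dif_pos, ι_sq_scalar, Qf_single]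

theorem eR_anti (m j k : ℕ) (h : j ≠ k) : eR m j * eR m k = - (eR m k * eR m j) := by
  unfold eR
  split_ifs with h1 h2
  · rw [ι_mul_ι_comm, Qf_add_single]
    simp [h]
  all_goals simp

/-- sign for conjugation -/
def epsC (k : ℕ) (i : ℕ) : ℝ := if i = k then 1 else -1
/-- sign for flipping -/
def epsF (k : ℕ) (i : ℕ) : ℝ := if i = k then -1 else 1
theorem epsC_h (k : ℕ) (i : ℕ) : epsC k i * epsC k i = 1 := by unfold epsC; split_ifs <;> simp
theorem epsF_h (k : ℕ) (i : ℕ) : epsF k i * epsF k i = 1 := by unfold epsF; split_ifs <;> simp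

theorem eR_conj (m k : ℕ) (x : Cl m) :
    eR m k * x = sg m (epsC k) (epsC_h k) x * eR m k := by
  by_cases hk : k < m
  swap
  · simp [eR, hk]
  induction x using CliffordAlgebra.left_induction with
  | algebraMap r => rw [AlgHom.commutes, Algebra.commutes]
  | add x y hx hy => simp only [map_add, mul_add, add_mul, hx, hy]
  | ι_mul x v hx =>
    rw [map_mul, mul_assoc, ← hx, ← mul_assoc, ← mul_assoc]
    congr 1
    have h3 : sgnIso m (epsC k) (epsC_h k) v = (2 * v ⟨k, hk⟩) • Pi.single (⟨k, hk⟩ : Fin m) 1 - v := by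
      ext i
      change epsC k i * _ = _
      by_cases hi : i = ⟨k, hk⟩
      · subst hi; simp [epsC]; ring
      · have : (i : ℕ) ≠ k := fun h => hi (Fin.ext h)
        simp [epsC, hi, this]
    have h4 := eR_sq m k hk
    simp only [eR, hk, dif_pos] at h4 ⊢
    rw [sg, map_apply_ι, h3, map_sub, map_smul, sub_mul, smul_mul_assoc, h4, ι_mul_ι_comm,
      Qf_add_single, Algebra.smul_def,
      ← (algebraMap ℝ (Cl m)).map_mul]
    congr 2
    simp only []; ring

theorem scalR_tr (m : ℕ) (a x : Cl m) : scalR m (a * x) = scalR m (x * a) := by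
  have gen : ∀ k, k < m → ∀ x, scalR m (eR m k * x) = scalR m (x * eR m k) := by
    intro k hk x
    have h1 := aux_scalR_map m (sgnIso m (epsC k) (epsC_h k)) (x * eR m k)
    rw [← h1]
    change _ = scalR m (sg m (epsC k) (epsC_h k) (x * eR m k))
    rw [map_mul (sg m (epsC k) (epsC_h k)), sg_eR, eR_conj]
    simp [epsC]
  induction a using CliffordAlgebra.induction generalizing x with
  | algebraMap r => rw [Algebra.commutes]
  | ι v =>
    have : CliffordAlgebra.ι (Qf m) v = ∑ i : Fin m, v i • eR m i := by
      conv_lhs => rw [pi_eq_sum_univ' v]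
      rw [map_sum]
      refine Finset.sum_congr rfl fun i _ => ?_
      rw [map_smul]
      simp [eR]
    rw [this, Finset.sum_mul, Finset.mul_sum, map_sum, map_sum]
    refine Finset.sum_congr rfl fun i _ => ?_
    rw [smul_mul_assoc, mul_smul_comm, map_smul, map_smul, gen i i.2]
  | mul a b ha hb => rw [mul_assoc, ha, mul_assoc, hb, mul_assoc]
  | add a b ha hb => simp only [add_mul, mul_add, map_add, ha, hb]

theorem c_nm {m : ℕ} (x y : CCl m) : -x * y = -(x * y) := neg_mul x y
theorem c_mn {m : ℕ} (x y : CCl m) : x * -y = -(x * y) := mul_neg x y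
theorem c_nn {m : ℕ} (x y : CCl m) : -x * -y = x * y := neg_mul_neg x y
theorem c_ms {m : ℕ} (c : ℂ) (x y : CCl m) : x * c • y = c • (x * y) := mul_smul_comm c x y
theorem c_sm {m : ℕ} (c : ℂ) (x y : CCl m) : c • x * y = c • (x * y) := smul_mul_assoc c x y

/-- complexified sign automorphism -/
noncomputable def sC (m k : ℕ) : CCl m →ₐ[ℂ] CCl m :=
  Algebra.TensorProduct.map (AlgHom.id ℂ ℂ) (sg m (epsF k) (epsF_h k))

theorem sC_eC (m k j : ℕ) : sC m k (eC m j) = if j = k then - eC m j else eC m j := by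
  simp only [sC, eC, inc, Algebra.TensorProduct.includeRight_apply,
    Algebra.TensorProduct.map_tmul, sg_eR, epsF]
  split_ifs <;> simp [TensorProduct.tmul_neg]

theorem scalC_tmul (m : ℕ) (z : ℂ) (x : Cl m) : scalC m (z ⊗ₜ x) = scalR m x • z := by
  simp [scalC]

theorem scalC_sC (m k : ℕ) (x : CCl m) : scalC m (sC m k x) = scalC m x := by
  induction x using TensorProduct.induction_on with
  | zero => simp
  | tmul z x =>
    simp only [sC, Algebra.TensorProduct.map_tmul, scalC_tmul]
    rw [sg, aux_scalR_map]; rfl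
  | add x y hx hy => simp only [map_add, hx, hy]

theorem scalC_tr (m : ℕ) (x y : CCl m) : scalC m (x * y) = scalC m (y * x) := by
  induction x using TensorProduct.induction_on with
  | zero => simp
  | add x y hx hy => simp only [map_add, add_mul, mul_add, hx, hy]
  | tmul z x =>
    induction y using TensorProduct.induction_on with
    | zero => simp
    | add x y hx hy => simp only [map_add, add_mul, mul_add, hx, hy]
    | tmul w y =>
      rw [Algebra.TensorProduct.tmul_mul_tmul, Algebra.TensorProduct.tmul_mul_tmul,
        scalC_tmul, scalC_tmul, scalR_tr, mul_comm]

theorem scalC_smul (m : ℕ) (c : ℂ) (x : CCl m) : scalC m (c • x) = c * scalC m x := by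
  induction x using TensorProduct.induction_on with
  | zero => simp
  | add x y hx hy => simp only [map_add, smul_add, mul_add, hx, hy]
  | tmul z x => rw [TensorProduct.smul_tmul', scalC_tmul, scalC_tmul]; simp; ring

theorem scalC_one (m : ℕ) : scalC m 1 = 1 := by
  rw [Algebra.TensorProduct.one_def, scalC_tmul, aux_scalR_one, one_smul]

theorem scalC_odd (m k : ℕ) (x : CCl m) (h : sC m k x = -x) : scalC m x = 0 := by
  have := scalC_sC m k x
  rw [h, map_neg] at this
  exact self_eq_neg.mp this.symm

theorem starC_mul (m : ℕ) (x y : CCl m) : starC m (x * y) = starC m y * starC m x := by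
  induction x using TensorProduct.induction_on with
  | zero => simp
  | add x y hx hy => simp only [map_add, add_mul, mul_add, hx, hy]
  | tmul z x =>
    induction y using TensorProduct.induction_on with
    | zero => simp
    | add x y hx hy => simp only [map_add, add_mul, mul_add, hx, hy]
    | tmul w y =>
      simp [starC, mul_comm]

theorem starC_smul (m : ℕ) (c : ℂ) (x : CCl m) :
    starC m (c • x) = (starRingEnd ℂ c) • starC m x := by
  induction x using TensorProduct.induction_on with
  | zero => simp
  | add x y hx hy => simp only [map_add, smul_add, hx, hy]
  | tmul z x => simp [starC, TensorProduct.smul_tmul']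

theorem starC_eC (m k : ℕ) : starC m (eC m k) = eC m k := by
  simp only [starC, eC, inc, Algebra.TensorProduct.includeRight_apply, TensorProduct.map_tmul, eR]
  split_ifs <;> simp

theorem eC_sq (m k : ℕ) (hk : k < m) :
    eC m k * eC m k = if k = 0 then 1 else -1 := by
  rw [eC, ← map_mul, eR_sq m k hk]
  split_ifs <;> simp

theorem eC_anti (m j k : ℕ) (h : j ≠ k) : eC m j * eC m k = - (eC m k * eC m j) := by
  rw [eC, eC, ← map_mul, eR_anti m j k h, map_neg, map_mul]

theorem dag_mul (m : ℕ) (hm : 0 < m) (x y : CCl m) :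
    dagger m (x * y) = dagger m y * dagger m x := by
  have h := eC_sq m 0 hm
  simp only [if_true] at h
  simp only [dagger, starC_mul]
  calc _ = eC m 0 * starC m y * 1 * starC m x * eC m 0 := by simp only [mul_assoc, mul_one, one_mul]
    _ = _ := by rw [← h]; simp only [mul_assoc]

theorem dag_smul (m : ℕ) (c : ℂ) (x : CCl m) :
    dagger m (c • x) = (starRingEnd ℂ c) • dagger m x := by
  rw [dagger, starC_smul, c_ms, c_sm, ← dagger]

theorem dag_add (m : ℕ) (x y : CCl m) : dagger m (x + y) = dagger m x + dagger m y := by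
  simp [dagger, mul_add, add_mul]

theorem dag_one (m : ℕ) (hm : 0 < m) : dagger m 1 = 1 := by
  have h := eC_sq m 0 hm
  simp only [if_true] at h
  simp [dagger, starC, Algebra.TensorProduct.one_def]
  simpa [← Algebra.TensorProduct.one_def] using h

theorem dag_eC0 (m : ℕ) (hm : 0 < m) : dagger m (eC m 0) = eC m 0 := by
  have h := eC_sq m 0 hm
  simp only [if_true] at h
  rw [dagger, starC_eC, h, one_mul]

theorem dag_eC (m k : ℕ) (hm : 0 < m) (hk : k ≠ 0) : dagger m (eC m k) = - eC m k := by
  have h := eC_sq m 0 hm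
  simp only [if_true] at h
  rw [dagger, starC_eC, eC_anti m 0 k hk.symm, c_nm, mul_assoc, h, mul_one]

/-- factor -/
noncomputable def fac (m j : ℕ) : CCl m :=
  (2 : ℂ)⁻¹ • ((1 : CCl m) + Complex.I • (eC m (2 * j + 1) * eC m (2 * j + 2)))

theorem dag_fac (m j : ℕ) (hm : 0 < m) : dagger m (fac m j) = fac m j := by
  rw [fac, dag_smul, dag_add, dag_one m hm, dag_smul, dag_mul m hm, dag_eC m _ hm (by omega),
    dag_eC m _ hm (by omega), c_nn, eC_anti m (2*j+2) (2*j+1) (by omega)]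
  simp only [map_inv₀, map_ofNat, Complex.conj_I, neg_smul, smul_neg, neg_neg]

theorem pair_sq (m j : ℕ) (h : 2 * j + 2 < m) :
    (eC m (2 * j + 1) * eC m (2 * j + 2)) * (eC m (2 * j + 1) * eC m (2 * j + 2)) = -1 := by
  have h1 := eC_sq m (2*j+1) (by omega)
  have h2 := eC_sq m (2*j+2) h
  simp only [Nat.add_eq_zero_iff, one_ne_zero, OfNat.ofNat_ne_zero, and_false, if_false] at h1 h2
  rw [mul_assoc, ← mul_assoc (eC m (2*j+2)), eC_anti m (2*j+2) (2*j+1) (by omega), c_nm,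
    mul_assoc, h2, c_mn, c_mn, c_mn, neg_neg, mul_one, h1]

theorem fac_sq (m j : ℕ) (h : 2 * j + 2 < m) : fac m j * fac m j = fac m j := by
  have := pair_sq m j h
  rw [fac]
  generalize eC m (2 * j + 1) * eC m (2 * j + 2) = p at *
  simp only [smul_mul_smul_comm, mul_add, add_mul, this, mul_one, one_mul, Complex.I_mul_I]
  module

theorem comm_pair (m i j k : ℕ) (h1 : i ≠ j) (h2 : i ≠ k) :
    Commute (eC m i) (eC m j * eC m k) := by
  rw [commute_iff_eq, ← mul_assoc, eC_anti m i j h1, c_nm, mul_assoc, eC_anti m i k h2, c_mn,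
    neg_neg, mul_assoc]

theorem comm_fac_of (m j : ℕ) (x : CCl m) (h : Commute x (eC m (2 * j + 1) * eC m (2 * j + 2))) :
    Commute x (fac m j) :=
  ((Commute.one_right x).add_right (h.smul_right _)).smul_right _

theorem comm_fac (m i j : ℕ) (h : i ≠ j) : Commute (fac m i) (fac m j) :=
  comm_fac_of _ _ _ (comm_fac_of _ _ _ ((comm_pair m _ _ _ (by omega) (by omega)).mul_left
    (comm_pair m _ _ _ (by omega) (by omega))).symm).symm

theorem facs_succ (m k : ℕ) : (facs m (k + 1)).prod = (facs m k).prod * fac m k := by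
  simp [facs, fac, List.range_succ]

theorem comm_facs (m k : ℕ) (x : CCl m) (h : ∀ j < k, Commute x (fac m j)) :
    Commute x (facs m k).prod := by
  apply Commute.list_prod_right
  intro y hy
  simp only [facs, List.mem_map, List.mem_range] at hy
  obtain ⟨j, hj, rfl⟩ := hy
  exact h j hj

theorem facs_props (m k : ℕ) (h : 2 * k < m) :
    dagger m (facs m k).prod = (facs m k).prod ∧
    (facs m k).prod * (facs m k).prod = (facs m k).prod := by
  induction k with
  | zero => simp [facs, dag_one m h]
  | succ k ih =>
    obtain ⟨h1, h2⟩ := ih (by omega)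
    have hc : Commute (fac m k) (facs m k).prod :=
      comm_facs _ _ _ fun j hj => comm_fac _ _ _ (by omega)
    rw [facs_succ]
    constructor
    · rw [dag_mul m (by omega), h1, dag_fac m _ (by omega), hc.eq]
    · rw [mul_assoc, ← mul_assoc (fac m k), hc.eq, mul_assoc, fac_sq m k (by omega), ← mul_assoc, h2]

theorem t_props (m k : ℕ) (h : 2 * k < m) :
    dagger m (tIdem m k) = tIdem m k ∧ tIdem m k * tIdem m k = tIdem m k := by
  obtain ⟨h1, h2⟩ := facs_props m k h
  have hm : 0 < m := by omega
  have h0 := eC_sq m 0 hm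
  simp only [if_true] at h0
  have hd : dagger m ((2 : ℂ)⁻¹ • ((1 : CCl m) + eC m 0)) = (2 : ℂ)⁻¹ • ((1 : CCl m) + eC m 0) := by
    rw [dag_smul, dag_add, dag_one m hm, dag_eC0 m hm]; simp only [map_inv₀, map_ofNat]
  have hs : ((2 : ℂ)⁻¹ • ((1 : CCl m) + eC m 0)) * ((2 : ℂ)⁻¹ • ((1 : CCl m) + eC m 0))
      = (2 : ℂ)⁻¹ • ((1 : CCl m) + eC m 0) := by
    simp only [smul_mul_smul_comm, mul_add, add_mul, h0, mul_one, one_mul]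
    module
  have hc : Commute ((2 : ℂ)⁻¹ • ((1 : CCl m) + eC m 0)) (facs m k).prod := by
    apply comm_facs
    intro j _
    apply comm_fac_of
    exact ((Commute.one_left _).add_left (comm_pair m _ _ _ (by omega) (by omega))).smul_left _
  unfold tIdem
  generalize (2 : ℂ)⁻¹ • ((1 : CCl m) + eC m 0) = p at *
  constructor
  · rw [dag_mul m hm, hd, h1, hc.eq]
  · rw [mul_assoc, ← mul_assoc _ p, ← hc.eq, mul_assoc p, h2, ← mul_assoc, hs]

theorem sC_facs (m k n : ℕ) (h : 2 * k < n) : sC m n (facs m k).prod = (facs m k).prod := by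
  induction k with
  | zero => simp [facs]
  | succ k ih =>
    rw [facs_succ, map_mul, ih (by omega), fac, map_smul, map_add, map_smul, map_mul, map_one,
      sC_eC, sC_eC, if_neg (by omega), if_neg (by omega)]

theorem scal_facs (m k : ℕ) (x : CCl m) (hx : ∀ j < k, sC m (2 * j + 2) x = x) :
    scalC m (x * (facs m k).prod) = (2⁻¹ : ℂ) ^ k * scalC m x := by
  induction k with
  | zero => simp [facs]
  | succ k ih =>
    rw [facs_succ, ← mul_assoc, fac, mul_smul_comm, scalC_smul, mul_add, map_add, mul_one,
      mul_smul_comm, scalC_smul, ih fun j hj => hx j (by omega),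
      scalC_odd m (2 * k + 2) (_ * (_ * _)), pow_succ]
    · ring
    · rw [map_mul, map_mul, map_mul, hx k (by omega), sC_facs m k _ (by omega), sC_eC, sC_eC,
        if_neg (by omega), if_pos rfl, c_mn, c_mn]

theorem scal_t (m k : ℕ) (x : CCl m) (hx : ∀ j ≤ k, sC m (2 * j) x = x) :
    scalC m (x * tIdem m k) = (2⁻¹ : ℂ) ^ (k + 1) * scalC m x := by
  rw [tIdem, ← mul_assoc, scal_facs, mul_smul_comm, scalC_smul, mul_add, map_add, mul_one,
    scalC_odd m 0 (x * eC m 0)]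
  · ring
  · rw [map_mul, sC_eC, if_pos rfl]
    have := hx 0 (by omega)
    simp only [mul_zero] at this
    rw [this, c_mn]
  · intro j hj
    have := hx (j + 1) (by omega)
    rw [map_mul, map_smul, map_add, map_one, sC_eC, if_neg (by omega)]
    rw [show 2 * j + 2 = 2 * (j + 1) by ring, this]

/-- list product -/
noncomputable def cl (d : ℕ) (l : List (Fin d)) : CCl (2 * d) :=
  (l.map fun j => eC (2 * d) (2 * (j : ℕ) + 1)).prod

theorem cl_even (d k : ℕ) (hd : 1 ≤ d) (l : List (Fin d)) :
    sC (2 * d) (2 * k) (cl d l) = cl d l ∧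
    sC (2 * d) (2 * k) (dagger (2 * d) (cl d l)) = dagger (2 * d) (cl d l) := by
  induction l with
  | nil => simp [cl, dag_one (2 * d) (by omega)]
  | cons a l ih =>
    obtain ⟨h1, h2⟩ := ih
    have : cl d (a :: l) = eC (2 * d) (2 * (a : ℕ) + 1) * cl d l := by simp [cl]
    rw [this, dag_mul _ (by omega), dag_eC _ _ (by omega) (by omega)]
    simp only [map_mul, map_neg, h1, h2, sC_eC]
    rw [if_neg (by omega)]
    exact ⟨rfl, rfl⟩

theorem cl_odd (d : ℕ) (k : Fin d) (hd : 1 ≤ d) (l : List (Fin d)) (hl : l.Nodup) :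
    sC (2 * d) (2 * k + 1) (cl d l) = (if k ∈ l then (-1 : ℂ) else 1) • cl d l ∧
    sC (2 * d) (2 * k + 1) (dagger (2 * d) (cl d l))
      = (if k ∈ l then (-1 : ℂ) else 1) • dagger (2 * d) (cl d l) := by
  induction l with
  | nil => simp [cl, dag_one (2 * d) (by omega)]
  | cons a l ih =>
    rw [List.nodup_cons] at hl
    obtain ⟨h1, h2⟩ := ih hl.2
    have : cl d (a :: l) = eC (2 * d) (2 * (a : ℕ) + 1) * cl d l := by simp [cl]
    rw [this, dag_mul _ (by omega), dag_eC _ _ (by omega) (by omega)]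
    simp only [map_mul, map_neg, h1, h2, sC_eC]
    by_cases hk : k = a
    · subst hk
      simp [hl.1, c_nm, c_mn]
    · have h3 : ¬ (2 * (a : ℕ) + 1 = 2 * (k : ℕ) + 1) := by
        intro h
        exact hk (Fin.ext (by omega))
      rw [if_neg h3]
      by_cases hkl : k ∈ l <;> simp [hk, hkl, c_nm, c_mn]

theorem cl_norm (d : ℕ) (hd : 1 ≤ d) (l : List (Fin d)) :
    dagger (2 * d) (cl d l) * cl d l = 1 := by
  induction l with
  | nil => simp [cl, dag_one (2 * d) (by omega)]
  | cons a l ih =>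
    have : cl d (a :: l) = eC (2 * d) (2 * (a : ℕ) + 1) * cl d l := by simp [cl]
    have h2 := eC_sq (2 * d) (2 * (a : ℕ) + 1) (by omega)
    rw [if_neg (by omega)] at h2
    rw [this, dag_mul _ (by omega), dag_eC _ _ (by omega) (by omega), mul_assoc,
      ← mul_assoc (-_), c_nm, h2, neg_neg, one_mul, ih]

theorem cl_orth (d : ℕ) (hd : 1 ≤ d) (S T : Finset (Fin d)) :
    scalC (2 * d) (dagger (2 * d) (cElt d S) * cElt d T) = if S = T then 1 else 0 := by
  split_ifs with h
  · subst h
    rw [show cElt d S = cl d (S.sort (· ≤ ·)) from rfl, cl_norm d hd, scalC_one]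
  · obtain ⟨k, hk⟩ : ∃ k, ¬ (k ∈ S ↔ k ∈ T) := by
      by_contra hc
      push Not at hc
      exact h (Finset.ext hc)
    apply scalC_odd _ (2 * k + 1)
    rw [map_mul, show cElt d S = cl d (S.sort (· ≤ ·)) from rfl,
      show cElt d T = cl d (T.sort (· ≤ ·)) from rfl,
      (cl_odd d k hd _ (Finset.sort_nodup S _)).2, (cl_odd d k hd _ (Finset.sort_nodup T _)).1]
    simp only [Finset.mem_sort]
    by_cases h1 : k ∈ S <;> by_cases h2 : k ∈ T <;> simp_all [c_nm, c_mn]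

end aux10

/-- The τ^μ = (√2)^d c^μ t form an orthonormal system: (τ^μ, τ^ν) = δ^{μν}. -/
theorem stmt10 (d : ℕ) (hd : 1 ≤ d) (S T : Finset (Fin d)) :
    ip (2 * d) (tau d S) (tau d T) = if S = T then 1 else 0 := by
  have hr : ∀ (r : ℝ) (x : CCl (2 * d)), r • x = (r : ℂ) • x := by
    intro r x
    exact (Complex.coe_smul r x).symm
  obtain ⟨h1, h2⟩ := t_props (2 * d) (d - 1) (by omega)
  rw [ip, tau, tau, hr, hr, dag_smul, dag_mul _ (by omega), h1, smul_mul_smul_comm, scalC_smul,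
    scalC_tr (2 * d) (_ * _) (_ * _), ← mul_assoc (_ * _), mul_assoc (cElt d T), h2,
    scalC_tr (2 * d) (_ * _) _, ← mul_assoc (dagger _ _), scal_t, cl_orth d hd,
    Nat.sub_add_cancel hd, Complex.conj_ofReal]
  · have h3 : ((Real.sqrt 2 ^ d : ℝ) : ℂ) * ((Real.sqrt 2 ^ d : ℝ) : ℂ) = 2 ^ d := by
      rw [← Complex.ofReal_mul, ← mul_pow, Real.mul_self_sqrt (by norm_num)]
      simp
    rw [h3, ← mul_assoc, ← mul_pow]
    norm_num
  · intro j _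
    rw [map_mul]
    congr 1
    · exact (cl_even d j hd _).2
    · exact (cl_even d j hd _).1
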